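/- Let (Σ,σ) be a topologically transitive countable Markov shift with finite topological entropy h_top < ∞, and let φ : Σ → ℝ have summable variations with P(φ) < ∞. Suppose (CI) holds, i.e. δ_{φ,∞} < P(φ), and moreover δ_{φ,∞} + h_∞ < P(φ). Then φ is strongly positive recurrent. -/

import Mathlib

open Filter Set MeasureTheory Real ENNReal

namespace CMS

/-- Points of the full sequence space over the alphabet `ℕ`. -/
abbrev Pt : Type := ℕ → ℕ

/-- The (left) shift map `σ`. -/
def shiftMap : Pt → Pt := fun x i => x (i + 1)

/-- `x` is a point of the countable Markov shift `Σ` determined by the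
transition matrix `M` (identified with a relation on the alphabet `ℕ`). -/
def isAdmissible (M : ℕ → ℕ → Prop) (x : Pt) : Prop := ∀ i, M (x i) (x (i + 1))

/-- Topological transitivity: for all states `a, b` there is `N` with
`[a] ∩ σ⁻ᴺ [b] ≠ ∅`. -/
def TopTransitive (M : ℕ → ℕ → Prop) : Prop :=
  ∀ a b : ℕ, ∃ (N : ℕ) (x : Pt), isAdmissible M x ∧ x 0 = a ∧ x N = b

/-- Birkhoff sum `S_n φ`. -/
noncomputable def birkhoff (φ : Pt → ℝ) (n : ℕ) (x : Pt) : ℝ :=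
  ∑ i ∈ Finset.range n, φ (shiftMap^[i] x)

/-- `φ` has summable variations: `∑_{k ≥ 2} var_k(φ) < ∞`, expressed via a summable
sequence dominating the `k`-th variations. -/
def SummableVariations (M : ℕ → ℕ → Prop) (φ : Pt → ℝ) : Prop :=
  ∃ V : ℕ → ℝ, Summable V ∧
    ∀ k, 2 ≤ k → ∀ x y : Pt, isAdmissible M x → isAdmissible M y →
      (∀ i < k, x i = y i) → |φ x - φ y| ≤ V k

/-- `φ` is weakly Hölder continuous: `var_k(φ) ≤ C θ^k` for all `k ≥ 2`. -/
def WeaklyHolder (M : ℕ → ℕ → Prop) (φ : Pt → ℝ) : Prop :=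
  ∃ C θ : ℝ, 0 < C ∧ 0 < θ ∧ θ < 1 ∧
    ∀ k, 2 ≤ k → ∀ x y : Pt, isAdmissible M x → isAdmissible M y →
      (∀ i < k, x i = y i) → |φ x - φ y| ≤ C * θ ^ k

/-- Periodic points of period `n` in the 1-cylinder `[a]`. -/
def PerSet (M : ℕ → ℕ → Prop) (a n : ℕ) : Set Pt :=
  {x | isAdmissible M x ∧ shiftMap^[n] x = x ∧ x 0 = a}

/-- Periodic points of period `n` in `[a]` whose first return time to `[a]` is `n`. -/
def PerStarSet (M : ℕ → ℕ → Prop) (a n : ℕ) : Set Pt :=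
  {x | isAdmissible M x ∧ shiftMap^[n] x = x ∧ x 0 = a ∧ ∀ k, 0 < k → k < n → x k ≠ a}

/-- The Gurevich partition function `Z_n(φ, a)`. -/
noncomputable def Zn (M : ℕ → ℕ → Prop) (φ : Pt → ℝ) (a n : ℕ) : ℝ≥0∞ :=
  ∑' x : PerSet M a n, ENNReal.ofReal (Real.exp (birkhoff φ n x.1))

/-- The first-return partition function `Z_n^*(φ, a)`. -/
noncomputable def ZnStar (M : ℕ → ℕ → Prop) (φ : Pt → ℝ) (a n : ℕ) : ℝ≥0∞ :=
  ∑' x : PerStarSet M a n, ENNReal.ofReal (Real.exp (birkhoff φ n x.1))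

/-- The Gurevich pressure at the state `a`:
`P(φ) = limsup_n (1/n) log Z_n(φ, a)`, with values in `EReal`. -/
noncomputable def pressureAt (M : ℕ → ℕ → Prop) (φ : Pt → ℝ) (a : ℕ) : EReal :=
  Filter.limsup (fun n : ℕ => ((n : ℝ)⁻¹ : EReal) * ENNReal.log (Zn M φ a n)) atTop

/-- `limsup_n (1/n) log Z_n^*(φ, a)`, with values in `EReal`. -/
noncomputable def pressureStarAt (M : ℕ → ℕ → Prop) (φ : Pt → ℝ) (a : ℕ) : EReal :=
  Filter.limsup (fun n : ℕ => ((n : ℝ)⁻¹ : EReal) * ENNReal.log (ZnStar M φ a n)) atTop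

/-- Strong positive recurrence of `φ`, relative to the common value `P` of the
Gurevich pressure: for some state `a`, `limsup_n (1/n) log Z_n^*(φ,a) < P(φ)`. -/
def SPR (M : ℕ → ℕ → Prop) (φ : Pt → ℝ) (P : ℝ) : Prop :=
  ∃ a : ℕ, pressureStarAt M φ a < (P : EReal)

/-- The `F`-property: for every state `a` and every `n ≥ 1` there are only finitely
many periodic points of period `n` in `[a]`. -/
def FProperty (M : ℕ → ℕ → Prop) : Prop :=
  ∀ a n : ℕ, 0 < n → (PerSet M a n).Finite

/-- `χ_per(φ) = sup { (1/n) S_n φ(x) : σ^n x = x, n ∈ ℕ }`, with values in `EReal`. -/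
noncomputable def chiPer (M : ℕ → ℕ → Prop) (φ : Pt → ℝ) : EReal :=
  ⨆ p : {p : Pt × ℕ // isAdmissible M p.1 ∧ 0 < p.2 ∧ shiftMap^[p.2] p.1 = p.1},
    ((birkhoff φ p.1.2 p.1.1 / (p.1.2 : ℝ) : ℝ) : EReal)

/-- `x` lies in a cylinder belonging to `B(n, M', q)`: it is admissible,
`x 0 ≤ q`, `x n ≤ q` and `#{0 ≤ k ≤ n : x k ≤ q} ≤ (n+1)/M'`. -/
def inBSet (M : ℕ → ℕ → Prop) (n M' q : ℕ) (x : Pt) : Prop :=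
  isAdmissible M x ∧ x 0 ≤ q ∧ x n ≤ q ∧
    ((((Finset.range (n + 1)).filter (fun k => x k ≤ q)).card : ℝ) ≤ (n + 1 : ℝ) / (M' : ℝ))

/-- `z_{φ,n}(M',q) = sup { (1/n) S_n φ(x) : x ∈ B for some B ∈ B(n,M',q) }`. -/
noncomputable def zPhi (M : ℕ → ℕ → Prop) (φ : Pt → ℝ) (n M' q : ℕ) : EReal :=
  ⨆ x : {x : Pt // inBSet M n M' q x}, ((birkhoff φ n x.1 / (n : ℝ) : ℝ) : EReal)

/-- The contraction at infinity
`δ_{φ,∞} = lim_{q→∞} lim_{M'→∞} limsup_{n→∞} z_{φ,n}(M',q)`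
(the inner limits exist by monotonicity, so they agree with `liminf`s). -/
noncomputable def deltaInf (M : ℕ → ℕ → Prop) (φ : Pt → ℝ) : EReal :=
  liminf (fun q : ℕ => liminf (fun M' : ℕ =>
    limsup (fun n : ℕ => zPhi M φ n M' q) atTop) atTop) atTop

/-- `z_n(M',q) = #B(n,M',q)`, the number of `(n+1)`-cylinders (i.e. admissible
words realized in `Σ`) in `B(n,M',q)`, counted in `ℝ≥0∞`. -/
noncomputable def zCount (M : ℕ → ℕ → Prop) (n M' q : ℕ) : ℝ≥0∞ :=
  ∑' _w : {w : Fin (n + 1) → ℕ //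
      (∃ x : Pt, isAdmissible M x ∧ ∀ i : Fin (n + 1), x (i : ℕ) = w i) ∧
      w 0 ≤ q ∧ w (Fin.last n) ≤ q ∧
      (((Finset.univ.filter (fun i : Fin (n + 1) => w i ≤ q)).card : ℝ) ≤ (n + 1 : ℝ) / (M' : ℝ))},
    (1 : ℝ≥0∞)

/-- The entropy at infinity
`h_∞ = lim_{q→∞} lim_{M'→∞} limsup_{n→∞} (1/n) log z_n(M',q)`. -/
noncomputable def hInfty (M : ℕ → ℕ → Prop) : EReal :=
  liminf (fun q : ℕ => liminf (fun M' : ℕ =>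
    limsup (fun n : ℕ => ((n : ℝ)⁻¹ : EReal) * ENNReal.log (zCount M n M' q)) atTop) atTop) atTop

end CMS

namespace CMS

lemma shiftMap_iterate_apply (n : ℕ) (x : Pt) (i : ℕ) : shiftMap^[n] x i = x (i + n) := by
  induction n generalizing x with
  | zero => rfl
  | succ n ih =>
    rw [Function.iterate_succ_apply, ih]
    simp only [shiftMap]
    congr 1

lemma isAdmissible.iterate {M : ℕ → ℕ → Prop} {x : Pt} (hx : isAdmissible M x) (n : ℕ) :
    isAdmissible M (shiftMap^[n] x) := by
  intro i
  rw [shiftMap_iterate_apply, shiftMap_iterate_apply, add_right_comm]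
  exact hx _

lemma birkhoff_add (φ : Pt → ℝ) (m n : ℕ) (x : Pt) :
    birkhoff φ (m + n) x = birkhoff φ m x + birkhoff φ n (shiftMap^[m] x) := by
  unfold birkhoff
  rw [Finset.sum_range_add]
  simp only [← Function.iterate_add_apply, add_comm]

/-- Bounded distortion of Birkhoff sums. -/
lemma SummableVariations.exists_distortion {M : ℕ → ℕ → Prop} {φ : Pt → ℝ}
    (h : SummableVariations M φ) :
    ∃ C : ℝ, ∀ (n : ℕ) (x y : Pt), isAdmissible M x → isAdmissible M y →
      (∀ i ≤ n, x i = y i) → birkhoff φ n x ≤ birkhoff φ n y + C := by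
  obtain ⟨V, hV, hvar⟩ := h
  refine ⟨∑' k, |V k|, fun n x y hx hy hxy => ?_⟩
  have key : birkhoff φ n x - birkhoff φ n y ≤ ∑ i ∈ Finset.range n, |V (n + 1 - i)| := by
    unfold birkhoff
    rw [← Finset.sum_sub_distrib]
    refine Finset.sum_le_sum fun i hi => ?_
    have hi' := Finset.mem_range.1 hi
    have := hvar (n + 1 - i) (by omega) _ _ (hx.iterate i) (hy.iterate i) (fun j hj => by
      rw [shiftMap_iterate_apply, shiftMap_iterate_apply]
      exact hxy _ (by omega))
    exact (le_abs_self _).trans (this.trans (le_abs_self _))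
  have hinj : Set.InjOn (fun i => n + 1 - i) (Finset.range n : Set ℕ) := by
    intro i hi j hj hij
    simp only [Finset.coe_range, Set.mem_Iio] at hi hj hij
    omega
  rw [← Finset.sum_image (f := fun k => |V k|) hinj] at key
  have := hV.abs.sum_le_tsum (Finset.image (fun i => n + 1 - i) (Finset.range n))
    (fun _ _ => abs_nonneg _)
  linarith

lemma eq_add_of_periodic {n : ℕ} {x : Pt} (hx : shiftMap^[n] x = x) (k : ℕ) :
    x (k + n) = x k := by
  rw [← shiftMap_iterate_apply n x k, hx]

lemma eq_mod_of_periodic {n : ℕ} {x : Pt} (hx : shiftMap^[n] x = x) (k : ℕ) :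
    x (k % n) = x k := by
  have h : ∀ j r, x (r + n * j) = x r := by
    intro j
    induction j with
    | zero => simp
    | succ j ih =>
      intro r
      rw [Nat.mul_succ, ← add_assoc, eq_add_of_periodic hx, ih]
  conv_rhs => rw [← Nat.mod_add_div k n, h]

lemma periodic_ext {n : ℕ} (hn : 0 < n) {x y : Pt} (hx : shiftMap^[n] x = x)
    (hy : shiftMap^[n] y = y) (h : ∀ k < n, x k = y k) : x = y := by
  funext k
  rw [← eq_mod_of_periodic hx, ← eq_mod_of_periodic hy]
  exact h _ (Nat.mod_lt _ hn)

/-- The periodic point following `x` for `s` steps and then `y` for `t` steps. -/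
def loopPt (x : Pt) (s : ℕ) (y : Pt) (t : ℕ) : Pt := fun k =>
  if k % (s + t) < s then x (k % (s + t)) else y (k % (s + t) - s)

section loopPt

variable {M : ℕ → ℕ → Prop} {x y : Pt} {s t : ℕ}

lemma loopPt_periodic : shiftMap^[s + t] (loopPt x s y t) = loopPt x s y t := by
  funext k
  rw [shiftMap_iterate_apply]
  simp [loopPt]

lemma loopPt_left (hst : 0 < s + t) (hx : x s = y 0) (hy : y t = x 0) {k : ℕ} (hk : k ≤ s) :
    loopPt x s y t k = x k := by
  unfold loopPt
  rcases hk.lt_or_eq with h | rfl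
  · rw [Nat.mod_eq_of_lt (by omega), if_pos h]
  · rcases Nat.eq_zero_or_pos t with rfl | ht
    · simp only [add_zero, Nat.mod_self] at hst ⊢
      rw [if_pos hst, hx, hy]
    · rw [Nat.mod_eq_of_lt (by omega), if_neg (lt_irrefl _), Nat.sub_self, hx]

lemma loopPt_right (hst : 0 < s + t) (hx : x s = y 0) (hy : y t = x 0) {k : ℕ} (hk : k ≤ t) :
    loopPt x s y t (s + k) = y k := by
  rcases hk.lt_or_eq with h | rfl
  · unfold loopPt
    rw [Nat.mod_eq_of_lt (by omega), if_neg (by omega)]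
    congr 1
    omega
  · have := eq_add_of_periodic (loopPt_periodic (x := x) (y := y) (s := s) (t := k)) 0
    rw [zero_add] at this
    rw [this, loopPt_left hst hx hy (Nat.zero_le _), hy]

lemma loopPt_admissible (hax : isAdmissible M x) (hay : isAdmissible M y) (hst : 0 < s + t)
    (hx : x s = y 0) (hy : y t = x 0) : isAdmissible M (loopPt x s y t) := by
  have key : ∀ r < s + t, M (loopPt x s y t r) (loopPt x s y t (r + 1)) := by
    intro r hr
    rcases lt_or_ge r s with h | h
    · rw [loopPt_left hst hx hy h.le, loopPt_left hst hx hy h]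
      exact hax r
    · obtain ⟨j, rfl⟩ := Nat.exists_eq_add_of_le h
      rw [add_assoc, loopPt_right hst hx hy (by omega), loopPt_right hst hx hy (by omega)]
      exact hay j
  intro k
  have hper := loopPt_periodic (x := x) (y := y) (s := s) (t := t)
  have h := key (k % (s + t)) (Nat.mod_lt _ hst)
  rw [eq_mod_of_periodic hper, ← eq_mod_of_periodic hper (k % (s + t) + 1), Nat.mod_add_mod,
    eq_mod_of_periodic hper] at h
  exact h

lemma birkhoff_add_le_loopPt {φ : Pt → ℝ} {C : ℝ}
    (hC : ∀ (n : ℕ) (x y : Pt), isAdmissible M x → isAdmissible M y →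
      (∀ i ≤ n, x i = y i) → birkhoff φ n x ≤ birkhoff φ n y + C)
    (hax : isAdmissible M x) (hay : isAdmissible M y) (hst : 0 < s + t)
    (hx : x s = y 0) (hy : y t = x 0) :
    birkhoff φ s x + birkhoff φ t y ≤ birkhoff φ (s + t) (loopPt x s y t) + 2 * C := by
  have hL := loopPt_admissible hax hay hst hx hy
  rw [birkhoff_add]
  have h1 := hC s x _ hax hL (fun i hi => (loopPt_left hst hx hy hi).symm)
  have h2 := hC t y _ hay (hL.iterate s) (fun i hi => by
    rw [shiftMap_iterate_apply, add_comm, loopPt_right hst hx hy hi])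
  linarith

end loopPt

/-- Every state is joined to `0` by a path meeting `0` only at its end. -/
lemma TopTransitive.exists_path_to_zero {M : ℕ → ℕ → Prop} (h : TopTransitive M) (i : ℕ) :
    ∃ (N : ℕ) (x : Pt), isAdmissible M x ∧ x 0 = i ∧ x N = 0 ∧ ∀ k < N, x k ≠ 0 := by
  obtain ⟨N, x, hx, h0, hN⟩ := h i 0
  have hex : ∃ n, x n = 0 := ⟨N, hN⟩
  exact ⟨Nat.find hex, x, hx, h0, Nat.find_spec hex, fun k hk => Nat.find_min hex hk⟩

/-- Every state is reached from `0` by a path meeting `0` only at its start. -/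
lemma TopTransitive.exists_path_from_zero {M : ℕ → ℕ → Prop} (h : TopTransitive M) (i : ℕ) :
    ∃ (N : ℕ) (x : Pt), isAdmissible M x ∧ x 0 = 0 ∧ x N = i ∧ ∀ k, 0 < k → k ≤ N → x k ≠ 0 := by
  obtain ⟨N, x, hx, h0, hN⟩ := h 0 i
  have hspec : x (Nat.findGreatest (fun j => x j = 0) N) = 0 :=
    Nat.findGreatest_spec (P := fun j => x j = 0) (Nat.zero_le N) h0
  have hle := Nat.findGreatest_le (P := fun j => x j = 0) N
  have hgr := fun k => Nat.findGreatest_is_greatest (P := fun j => x j = 0) (n := N) (k := k)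
  set j := Nat.findGreatest (fun j => x j = 0) N with hj
  refine ⟨N - j, shiftMap^[j] x, hx.iterate j, ?_, ?_, fun k hk hkN => ?_⟩
  · rw [shiftMap_iterate_apply, zero_add, hspec]
  · rw [shiftMap_iterate_apply, Nat.sub_add_cancel hle, hN]
  · rw [shiftMap_iterate_apply]
    exact hgr (k + j) (by omega) (by omega)

lemma tsum_le_tsum_of_injOn {α β : Type*} {s : Set α} {t : Set β} {f : α → ℝ≥0∞} {g : β → ℝ≥0∞}
    (e : α → β) (hm : MapsTo e s t) (hi : InjOn e s) (h : ∀ x ∈ s, f x ≤ g (e x)) :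
    ∑' x : s, f x ≤ ∑' y : t, g y :=
  calc ∑' x : s, f x ≤ ∑' x : s, g (hm.restrict e s t x) :=
        ENNReal.tsum_le_tsum fun x => h x x.2
    _ ≤ ∑' y : t, g y :=
        ENNReal.tsum_comp_le_tsum_of_injective (hm.restrict_inj.2 hi) (fun y : t => g y)

lemma tsum_prod_set {α β : Type*} (s : Set α) (t : Set β) (f : α → ℝ≥0∞) (g : β → ℝ≥0∞) :
    ∑' p : ↥(s ×ˢ t), f p.1.1 * g p.1.2 = (∑' x : s, f x) * ∑' y : t, g y := by
  rw [← (Equiv.Set.prod s t).symm.tsum_eq, ← ENNReal.tsum_mul_right]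
  refine (ENNReal.tsum_prod (f := fun (x : s) (y : t) => f x * g y)).trans ?_
  refine tsum_congr fun x => ?_
  rw [← ENNReal.tsum_mul_left]

lemma tsum_set_prod_eq (S : Set (ℕ × Pt)) (f : ℕ × Pt → ℝ≥0∞) :
    ∑' p : S, f p = ∑' n, ∑' x : {x | (n, x) ∈ S}, f (n, x) := by
  rw [tsum_subtype S f]
  refine (ENNReal.tsum_prod (f := fun n x => S.indicator f (n, x))).trans ?_
  refine tsum_congr fun n => ?_
  rw [tsum_subtype {x | (n, x) ∈ S} (fun x => f (n, x))]
  rfl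

lemma exists_count_eq (p : ℕ → Prop) [DecidablePred p] {m n : ℕ} (h : m < Nat.count p n) :
    ∃ t < n, p t ∧ Nat.count p t = m := by
  induction n with
  | zero => simp at h
  | succ n ih =>
    by_cases hm : m < Nat.count p n
    · obtain ⟨t, ht, h'⟩ := ih hm
      exact ⟨t, by omega, h'⟩
    · rw [Nat.count_succ] at h
      split_ifs at h with hp
      · exact ⟨n, by omega, hp, by omega⟩
      · omega

/-- Weight of the orbit segment of length `p.1` of `p.2`, normalised at exponent `c`. -/
noncomputable def weight (φ : Pt → ℝ) (c : ℝ) (p : ℕ × Pt) : ℝ≥0∞ :=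
  ENNReal.ofReal (Real.exp (birkhoff φ p.1 p.2 - p.1 * c))

/-- Loops at `0` of positive length, with their length. -/
def starLoops (M : ℕ → ℕ → Prop) : Set (ℕ × Pt) := {p | 0 < p.1 ∧ p.2 ∈ PerStarSet M 0 p.1}

/-- Loops at `0` of length at least `N`, returns to `0` allowed. -/
def longLoops (M : ℕ → ℕ → Prop) (N : ℕ) : Set (ℕ × Pt) :=
  {p | 0 < p.1 ∧ N ≤ p.1 ∧ p.2 ∈ PerSet M 0 p.1}

/-- First return loops at `0` with at least `m` visits to `{0, …, q}`. -/
def visitLoops (M : ℕ → ℕ → Prop) (q m : ℕ) : Set (ℕ × Pt) :=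
  {p | p ∈ starLoops M ∧ m ≤ Nat.count (fun k => p.2 k ≤ q) p.1}

lemma inv_mul_log_le_iff {n : ℕ} (hn : 0 < n) {z : ℝ≥0∞} {c : ℝ} :
    ((n : ℝ)⁻¹ : EReal) * ENNReal.log z ≤ (c : EReal) ↔
      z ≤ ENNReal.ofReal (Real.exp (n * c)) := by
  have hn0 : (0 : EReal) < ((n : ℝ) : EReal) := by exact_mod_cast hn
  rw [← EReal.div_eq_inv_mul, EReal.div_le_iff_le_mul hn0 (EReal.coe_ne_top _),
    ← ENNReal.log_le_log_iff, ENNReal.log_ofReal_of_pos (Real.exp_pos _), Real.log_exp,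
    EReal.coe_mul]

lemma eventually_le_exp_of_limsup_lt {Z : ℕ → ℝ≥0∞} {c : ℝ}
    (h : limsup (fun n : ℕ => ((n : ℝ)⁻¹ : EReal) * ENNReal.log (Z n)) atTop < (c : EReal)) :
    ∀ᶠ n : ℕ in atTop, Z n ≤ ENNReal.ofReal (Real.exp (n * c)) := by
  filter_upwards [eventually_lt_of_limsup_lt h, eventually_gt_atTop 0] with n hn hpos
  exact (inv_mul_log_le_iff hpos).1 hn.le

lemma limsup_le_of_eventually_le_exp {Z : ℕ → ℝ≥0∞} {c c' : ℝ} (hc : c < c') {K : ℝ≥0∞}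
    (hK : K ≠ ∞) (h : ∀ᶠ n : ℕ in atTop, Z n ≤ K * ENNReal.ofReal (Real.exp (n * c))) :
    limsup (fun n : ℕ => ((n : ℝ)⁻¹ : EReal) * ENNReal.log (Z n)) atTop ≤ (c' : EReal) := by
  refine limsup_le_of_le (h := ?_)
  have hlim : Tendsto (fun n : ℕ => Real.exp (n * (c' - c))) atTop atTop :=
    Real.tendsto_exp_atTop.comp
      (tendsto_natCast_atTop_atTop.atTop_mul_const (sub_pos.2 hc))
  filter_upwards [h, eventually_gt_atTop 0, hlim.eventually_ge_atTop K.toReal] with n hn hpos hge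
  rw [inv_mul_log_le_iff hpos]
  refine hn.trans ?_
  rw [← ENNReal.ofReal_toReal hK, ← ENNReal.ofReal_mul ENNReal.toReal_nonneg]
  refine ENNReal.ofReal_le_ofReal ?_
  calc K.toReal * Real.exp (n * c) ≤ Real.exp (n * (c' - c)) * Real.exp (n * c) := by gcongr
    _ = Real.exp (n * c') := by rw [← Real.exp_add]; ring_nf

lemma weight_eq_mul (φ : Pt → ℝ) (c : ℝ) (n : ℕ) (x : Pt) :
    weight φ c (n, x) =
      ENNReal.ofReal (Real.exp (-(n * c))) * ENNReal.ofReal (Real.exp (birkhoff φ n x)) := by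
  rw [weight, ← ENNReal.ofReal_mul (Real.exp_nonneg _), ← Real.exp_add]
  ring_nf

lemma weight_pos (φ : Pt → ℝ) (c : ℝ) (p : ℕ × Pt) : 0 < weight φ c p :=
  ENNReal.ofReal_pos.2 (Real.exp_pos _)

lemma continuous_weight (φ : Pt → ℝ) (p : ℕ × Pt) : Continuous fun c => weight φ c p := by
  unfold weight
  exact ENNReal.continuous_ofReal.comp (by fun_prop)

lemma tsum_weight_longLoops_ne_top {M : ℕ → ℕ → Prop} {φ : Pt → ℝ} {c₀ c : ℝ} (hc : c₀ < c)
    {N : ℕ} (hN : ∀ n ≥ N, Zn M φ 0 n ≤ ENNReal.ofReal (Real.exp (n * c₀))) :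
    ∑' p : longLoops M N, weight φ c p ≠ ∞ := by
  have hgeom : ∑' n : ℕ, ENNReal.ofReal (Real.exp (c₀ - c)) ^ n < ∞ := by
    rw [ENNReal.tsum_geometric, ENNReal.inv_lt_top, tsub_pos_iff_lt]
    rw [← ENNReal.ofReal_one]
    exact (ENNReal.ofReal_lt_ofReal_iff one_pos).2 (Real.exp_lt_one_iff.2 (by linarith))
  refine (lt_of_le_of_lt ?_ hgeom).ne
  rw [tsum_set_prod_eq]
  refine ENNReal.tsum_le_tsum fun n => ?_
  by_cases hn : N ≤ n
  · calc ∑' x : {x | (n, x) ∈ longLoops M N}, weight φ c (n, x)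
        = ENNReal.ofReal (Real.exp (-(n * c))) *
          ∑' x : {x | (n, x) ∈ longLoops M N}, ENNReal.ofReal (Real.exp (birkhoff φ n x)) := by
          rw [← ENNReal.tsum_mul_left]
          exact tsum_congr fun x => weight_eq_mul φ c n x
      _ ≤ ENNReal.ofReal (Real.exp (-(n * c))) * Zn M φ 0 n := by
          gcongr
          exact tsum_le_tsum_of_injOn (t := PerSet M 0 n)
            (f := fun x => ENNReal.ofReal (Real.exp (birkhoff φ n x)))
            (g := fun x => ENNReal.ofReal (Real.exp (birkhoff φ n x)))
            id (fun x hx => hx.2.2) (injOn_id _) (fun _ _ => le_rfl)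
      _ ≤ ENNReal.ofReal (Real.exp (-(n * c))) * ENNReal.ofReal (Real.exp (n * c₀)) := by
          gcongr
          exact hN n hn
      _ = ENNReal.ofReal (Real.exp (c₀ - c)) ^ n := by
          rw [← ENNReal.ofReal_mul (Real.exp_nonneg _), ← Real.exp_add,
            ← ENNReal.ofReal_pow (Real.exp_nonneg _), ← Real.exp_nat_mul]
          ring_nf
  · have : IsEmpty {x | (n, x) ∈ longLoops M N} := ⟨fun x => hn x.2.2.1⟩
    simp

/-- Prepending a first return loop maps long loops injectively to long loops. -/
lemma tsum_weight_starLoops_mul_le {M : ℕ → ℕ → Prop} {φ : Pt → ℝ} {C : ℝ}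
    (hC : ∀ (n : ℕ) (x y : Pt), isAdmissible M x → isAdmissible M y →
      (∀ i ≤ n, x i = y i) → birkhoff φ n x ≤ birkhoff φ n y + C) (c : ℝ) (N : ℕ) :
    (∑' p : starLoops M, weight φ c p) * ∑' p : longLoops M N, weight φ c p ≤
      ENNReal.ofReal (Real.exp (2 * C)) * ∑' p : longLoops M N, weight φ c p := by
  rw [← tsum_prod_set, ← ENNReal.tsum_mul_left]
  refine tsum_le_tsum_of_injOn
    (f := fun p : (ℕ × Pt) × (ℕ × Pt) => weight φ c p.1 * weight φ c p.2)
    (g := fun p => ENNReal.ofReal (Real.exp (2 * C)) * weight φ c p)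
    (fun p => (p.1.1 + p.2.1, loopPt p.1.2 p.1.1 p.2.2 p.2.1)) ?_ ?_ ?_
  · rintro ⟨⟨k, x⟩, ⟨n, y⟩⟩ ⟨⟨hk, hx, hxp, hx0, -⟩, ⟨hn, hNn, hy, hyp, hy0⟩⟩
    dsimp only at *
    have hxk : x k = y 0 := by rw [hy0, ← hx0, ← eq_add_of_periodic hxp 0, zero_add]
    have hyn : y n = x 0 := by rw [hx0, ← hy0, ← eq_add_of_periodic hyp 0, zero_add]
    exact ⟨by dsimp only; omega, by dsimp only; omega,
      loopPt_admissible hx hy (by omega) hxk hyn, loopPt_periodic,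
      by dsimp only; rw [loopPt_left (by omega) hxk hyn (Nat.zero_le _), hx0]⟩
  · rintro ⟨⟨k, x⟩, ⟨n, y⟩⟩ ⟨⟨hk, hx, hxp, hx0, hxs⟩, ⟨hn, hNn, hy, hyp, hy0⟩⟩
      ⟨⟨k', x'⟩, ⟨n', y'⟩⟩ ⟨⟨hk', hx', hxp', hx0', hxs'⟩, ⟨hn', hNn', hy', hyp', hy0'⟩⟩ heq
    dsimp only at *
    have hxk : x k = y 0 := by rw [hy0, ← hx0, ← eq_add_of_periodic hxp 0, zero_add]
    have hyn : y n = x 0 := by rw [hx0, ← hy0, ← eq_add_of_periodic hyp 0, zero_add]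
    have hxk' : x' k' = y' 0 := by rw [hy0', ← hx0', ← eq_add_of_periodic hxp' 0, zero_add]
    have hyn' : y' n' = x' 0 := by rw [hx0', ← hy0', ← eq_add_of_periodic hyp' 0, zero_add]
    obtain ⟨hlen, hL⟩ := Prod.mk.inj heq
    have hxL : ∀ j ≤ k, loopPt x k y n j = x j := fun j hj =>
      loopPt_left (by omega) hxk hyn hj
    have hxL' : ∀ j ≤ k', loopPt x k y n j = x' j := fun j hj => by
      rw [hL]; exact loopPt_left (by omega) hxk' hyn' hj
    have hkk : k = k' := by
      rcases lt_trichotomy k k' with h | h | h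
      · exact absurd (by rw [← hxL' k h.le, hxL k le_rfl, hxk, hy0]) (hxs' k hk h)
      · exact h
      · exact absurd (by rw [← hxL k' h.le, hxL' k' le_rfl, hxk', hy0']) (hxs k' hk' h)
    subst hkk
    obtain rfl : n = n' := by omega
    have hxx : x = x' := periodic_ext hk hxp hxp' fun j hj => by
      rw [← hxL j hj.le, hxL' j hj.le]
    have hyy : y = y' := periodic_ext hn hyp hyp' fun j hj => by
      rw [← loopPt_right (s := k) (by omega) hxk hyn hj.le, hL,
        loopPt_right (by omega) hxk' hyn' hj.le]
    rw [hxx, hyy]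
  · rintro ⟨⟨k, x⟩, ⟨n, y⟩⟩ ⟨⟨hk, hx, hxp, hx0, -⟩, ⟨hn, hNn, hy, hyp, hy0⟩⟩
    dsimp only at *
    have hxk : x k = y 0 := by rw [hy0, ← hx0, ← eq_add_of_periodic hxp 0, zero_add]
    have hyn : y n = x 0 := by rw [hx0, ← hy0, ← eq_add_of_periodic hyp 0, zero_add]
    have := birkhoff_add_le_loopPt hC hx hy (by omega) hxk hyn
    simp only [weight]
    rw [← ENNReal.ofReal_mul (Real.exp_nonneg _), ← ENNReal.ofReal_mul (Real.exp_nonneg _),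
      ← Real.exp_add, ← Real.exp_add]
    refine ENNReal.ofReal_le_ofReal (Real.exp_le_exp.2 ?_)
    push_cast
    linarith

lemma tsum_weight_starLoops_le_of_lt {M : ℕ → ℕ → Prop} {φ : Pt → ℝ} {C P c : ℝ}
    (hC : ∀ (n : ℕ) (x y : Pt), isAdmissible M x → isAdmissible M y →
      (∀ i ≤ n, x i = y i) → birkhoff φ n x ≤ birkhoff φ n y + C)
    (hP : pressureAt M φ 0 = (P : EReal)) (hc : P < c) :
    ∑' p : starLoops M, weight φ c p ≤ ENNReal.ofReal (Real.exp (2 * C)) := by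
  obtain ⟨c₀, hPc, hcc⟩ := exists_between hc
  obtain ⟨N, hN⟩ := eventually_atTop.1 (eventually_le_exp_of_limsup_lt (Z := Zn M φ 0) (c := c₀)
    (by unfold pressureAt at hP; rw [hP]; exact_mod_cast hPc))
  rcases (starLoops M).eq_empty_or_nonempty with he | ⟨⟨k, x⟩, hk, hx, hxp, hx0, -⟩
  · simp [he]
  · dsimp only at hk hx hxp hx0
    have hN' : ∀ n ≥ N + 1, Zn M φ 0 n ≤ ENNReal.ofReal (Real.exp (n * c₀)) :=
      fun n hn => hN n (by omega)
    have hmem : (k * (N + 1), x) ∈ longLoops M (N + 1) := by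
      refine ⟨Nat.mul_pos hk (Nat.succ_pos _), Nat.le_mul_of_pos_left _ hk, hx, ?_, hx0⟩
      rw [Function.iterate_mul]
      exact Function.iterate_fixed hxp _
    have hpos : ∑' p : longLoops M (N + 1), weight φ c p ≠ 0 :=
      ((weight_pos φ c _).trans_le
        (ENNReal.le_tsum (f := fun p : longLoops M (N + 1) => weight φ c p) ⟨_, hmem⟩)).ne'
    exact (ENNReal.mul_le_mul_iff_left hpos (tsum_weight_longLoops_ne_top hcc hN')).1
      (tsum_weight_starLoops_mul_le hC c (N + 1))

/-- The first return partition functions are summable at the critical exponent. -/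
lemma tsum_weight_starLoops_le {M : ℕ → ℕ → Prop} {φ : Pt → ℝ} {C P : ℝ}
    (hC : ∀ (n : ℕ) (x y : Pt), isAdmissible M x → isAdmissible M y →
      (∀ i ≤ n, x i = y i) → birkhoff φ n x ≤ birkhoff φ n y + C)
    (hP : pressureAt M φ 0 = (P : EReal)) :
    ∑' p : starLoops M, weight φ P p ≤ ENNReal.ofReal (Real.exp (2 * C)) := by
  rw [ENNReal.tsum_eq_iSup_sum]
  refine iSup_le fun s => ?_
  have hcont : Continuous fun c => ∑ p ∈ s, weight φ c p :=
    continuous_finsetSum s fun p _ => continuous_weight φ p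
  refine le_of_tendsto (x := nhdsWithin P (Ioi P)) (hcont.continuousWithinAt.tendsto) ?_
  filter_upwards [self_mem_nhdsWithin] with c hc
  exact (ENNReal.sum_le_tsum s).trans (tsum_weight_starLoops_le_of_lt hC hP hc)

/-- Cutting a loop at a visit to a finite set and closing up both pieces. -/
lemma exists_tsum_visitLoops_add_le {M : ℕ → ℕ → Prop} {φ : Pt → ℝ} {C : ℝ}
    (htrans : TopTransitive M)
    (hC : ∀ (n : ℕ) (x y : Pt), isAdmissible M x → isAdmissible M y →
      (∀ i ≤ n, x i = y i) → birkhoff φ n x ≤ birkhoff φ n y + C) (P : ℝ) (q : ℕ) :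
    ∃ K : ℝ≥0∞, K ≠ ∞ ∧ ∀ m k, 0 < m → 0 < k →
      ∑' p : visitLoops M q (m + k), weight φ P p ≤
        K * ((∑' p : visitLoops M q m, weight φ P p) * ∑' p : visitLoops M q k, weight φ P p) := by
  choose N e hea he0 heN heI using htrans.exists_path_to_zero
  choose N' f hf using htrans.exists_path_from_zero
  set κ : ℕ → ℝ := fun i =>
    5 * C - birkhoff φ (N i) (e i) - birkhoff φ (N' i) (f i) + (N i + N' i) * P with hκ
  refine ⟨∑' i : ((Finset.range (q + 1) : Finset ℕ) : Set ℕ), ENNReal.ofReal (Real.exp (κ i)),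
    ?_, ?_⟩
  · rw [Finset.tsum_subtype' (Finset.range (q + 1)) fun i => ENNReal.ofReal (Real.exp (κ i))]
    exact (ENNReal.sum_lt_top.2 fun _ _ => ENNReal.ofReal_lt_top).ne
  intro m k hm hk
  have hcut : ∀ p ∈ visitLoops M q (m + k), ∃ t < p.1, p.2 t ≤ q ∧
      Nat.count (fun k => p.2 k ≤ q) t = m := fun p hp =>
    exists_count_eq _ (lt_of_lt_of_le (by omega) hp.2)
  choose! T hTlt hTq hTm using hcut
  have hTpos : ∀ p ∈ visitLoops M q (m + k), 0 < T p := by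
    intro p hp
    rcases Nat.eq_zero_or_pos (T p) with h | h
    · have := hTm p hp
      rw [h, Nat.count_zero] at this
      omega
    · exact h
  -- compatibility of the endpoints of the two closed-up pieces
  have hend : ∀ p ∈ visitLoops M q (m + k), p.2 p.1 = 0 := fun p hp => by
    have := eq_add_of_periodic hp.1.2.2.1 0
    rw [zero_add] at this
    rw [this, hp.1.2.2.2.1]
  have hA1 : ∀ p ∈ visitLoops M q (m + k), p.2 (T p) = e (p.2 (T p)) 0 := fun p _ =>
    (he0 _).symm
  have hA2 : ∀ p ∈ visitLoops M q (m + k), e (p.2 (T p)) (N (p.2 (T p))) = p.2 0 := fun p hp => by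
    rw [heN, hp.1.2.2.2.1]
  have hB1 : ∀ p ∈ visitLoops M q (m + k),
      f (p.2 (T p)) (N' (p.2 (T p))) = shiftMap^[T p] p.2 0 := fun p _ => by
    rw [(hf _).2.2.1, shiftMap_iterate_apply, zero_add]
  have hB2 : ∀ p ∈ visitLoops M q (m + k),
      shiftMap^[T p] p.2 (p.1 - T p) = f (p.2 (T p)) 0 := fun p hp => by
    rw [(hf _).2.1, shiftMap_iterate_apply, Nat.sub_add_cancel (hTlt p hp).le, hend p hp]
  have hApos : ∀ p ∈ visitLoops M q (m + k), 0 < T p + N (p.2 (T p)) := fun p hp =>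
    Nat.add_pos_left (hTpos p hp) _
  have hBpos : ∀ p ∈ visitLoops M q (m + k), 0 < N' (p.2 (T p)) + (p.1 - T p) := fun p hp =>
    Nat.add_pos_right _ (Nat.sub_pos_of_lt (hTlt p hp))
  rw [← tsum_prod_set, ← tsum_prod_set _ _ (fun i => ENNReal.ofReal (Real.exp (κ i)))
    (fun p : (ℕ × Pt) × (ℕ × Pt) => weight φ P p.1 * weight φ P p.2)]
  refine tsum_le_tsum_of_injOn
    (g := fun z : ℕ × (ℕ × Pt) × (ℕ × Pt) =>
      ENNReal.ofReal (Real.exp (κ z.1)) * (weight φ P z.2.1 * weight φ P z.2.2))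
    (fun p => (p.2 (T p),
      (T p + N (p.2 (T p)), loopPt p.2 (T p) (e (p.2 (T p))) (N (p.2 (T p)))),
      (N' (p.2 (T p)) + (p.1 - T p),
        loopPt (f (p.2 (T p))) (N' (p.2 (T p))) (shiftMap^[T p] p.2) (p.1 - T p)))) ?_ ?_ ?_
  · intro p hp
    have hfi := hf (p.2 (T p))
    have hadm : isAdmissible M p.2 := hp.1.2.1
    have hstar := hp.1.2.2.2.2
    refine ⟨?_, ⟨⟨hApos p hp, ?_, loopPt_periodic, ?_, ?_⟩, ?_⟩,
      ⟨⟨hBpos p hp, ?_, loopPt_periodic, ?_, ?_⟩, ?_⟩⟩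
    · simpa [Nat.lt_succ_iff] using hTq p hp
    · exact loopPt_admissible hadm (hea _) (hApos p hp) (hA1 p hp) (hA2 p hp)
    · dsimp only
      rw [loopPt_left (hApos p hp) (hA1 p hp) (hA2 p hp) (Nat.zero_le _), hp.1.2.2.2.1]
    · intro j hj0 hj
      dsimp only at hj ⊢
      rcases lt_or_ge j (T p) with h | h
      · rw [loopPt_left (hApos p hp) (hA1 p hp) (hA2 p hp) h.le]
        exact hstar j hj0 (h.trans (hTlt p hp))
      · obtain ⟨l, rfl⟩ := Nat.exists_eq_add_of_le h
        rw [loopPt_right (hApos p hp) (hA1 p hp) (hA2 p hp) (by omega)]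
        exact heI _ l (by omega)
    · dsimp only
      rw [Nat.count_add]
      refine le_trans (le_of_eq ?_) (Nat.le_add_right _ _)
      rw [← hTm p hp, Nat.count_eq_card_filter_range, Nat.count_eq_card_filter_range]
      congr 1
      refine Finset.filter_congr fun j hj => ?_
      rw [loopPt_left (hApos p hp) (hA1 p hp) (hA2 p hp) (Finset.mem_range.1 hj).le]
    · exact loopPt_admissible hfi.1 (hadm.iterate _) (hBpos p hp) (hB1 p hp) (hB2 p hp)
    · dsimp only
      rw [loopPt_left (hBpos p hp) (hB1 p hp) (hB2 p hp) (Nat.zero_le _), hfi.2.1]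
    · intro j hj0 hj
      dsimp only at hj ⊢
      rcases le_or_gt j (N' (p.2 (T p))) with h | h
      · rw [loopPt_left (hBpos p hp) (hB1 p hp) (hB2 p hp) h]
        exact hfi.2.2.2 j hj0 h
      · obtain ⟨l, rfl⟩ := Nat.exists_eq_add_of_le h.le
        rw [loopPt_right (hBpos p hp) (hB1 p hp) (hB2 p hp) (by omega), shiftMap_iterate_apply]
        exact hstar _ (by omega) (by omega)
    · have hcount := hp.2
      have hlt := hTlt p hp
      rw [show p.1 = T p + (p.1 - T p) by omega, Nat.count_add, hTm p hp] at hcount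
      dsimp only
      rw [Nat.count_add]
      refine le_trans (Nat.le_of_add_le_add_left hcount)
        (le_trans (le_of_eq ?_) (Nat.le_add_left _ _))
      rw [Nat.count_eq_card_filter_range, Nat.count_eq_card_filter_range]
      congr 1
      refine Finset.filter_congr fun j hj => ?_
      rw [loopPt_right (hBpos p hp) (hB1 p hp) (hB2 p hp) (Finset.mem_range.1 hj).le,
        shiftMap_iterate_apply, add_comm]
  · intro p hp p' hp' heq
    simp only [Prod.mk.injEq] at heq
    obtain ⟨hi, ⟨hl1, hL1⟩, ⟨hl2, hL2⟩⟩ := heq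
    have hA1p := hA1 p hp
    have hA2p := hA2 p hp
    have hB1p := hB1 p hp
    have hB2p := hB2 p hp
    have hAp := hApos p hp
    have hBp := hBpos p hp
    have hA2p' := hA2 p' hp'
    have hB1p' := hB1 p' hp'
    have hB2p' := hB2 p' hp'
    have hAp' := hApos p' hp'
    have hBp' := hBpos p' hp'
    rw [← hi] at hl1 hl2 hL1 hL2 hA2p' hB1p' hB2p' hAp' hBp'
    have ht : T p = T p' := by omega
    have h1 := hTlt p hp
    have h2 := hTlt p' hp'
    have hn : p.1 = p'.1 := by omega
    refine Prod.ext hn (periodic_ext hp.1.1 hp.1.2.2.1 (by rw [hn]; exact hp'.1.2.2.1) ?_)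
    intro j hj
    rcases lt_or_ge j (T p) with h | h
    · rw [← loopPt_left hAp hA1p hA2p h.le, hL1,
        loopPt_left hAp' (hi.symm.trans hA1p) hA2p' (by omega)]
    · obtain ⟨l, rfl⟩ := Nat.exists_eq_add_of_le h
      have e1 := loopPt_right hBp hB1p hB2p (k := l) (by omega)
      have e2 := loopPt_right hBp' hB1p' hB2p' (k := l) (by omega)
      rw [hL2, e2, shiftMap_iterate_apply, shiftMap_iterate_apply, ← ht] at e1
      rw [add_comm, e1]
  · intro p hp
    have hfi := hf (p.2 (T p))
    have hadm : isAdmissible M p.2 := hp.1.2.1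
    have b1 := birkhoff_add_le_loopPt hC hadm (hea _) (hApos p hp) (hA1 p hp) (hA2 p hp)
    have b2 := birkhoff_add_le_loopPt hC hfi.1 (hadm.iterate _) (hBpos p hp) (hB1 p hp) (hB2 p hp)
    have b3 := birkhoff_add φ (T p) (p.1 - T p) p.2
    have hlt := hTlt p hp
    rw [Nat.add_sub_cancel' hlt.le] at b3
    have hC0 : 0 ≤ C := by
      have := hC 0 _ _ hadm hadm fun _ _ => rfl
      linarith
    simp only [weight]
    rw [← ENNReal.ofReal_mul (Real.exp_nonneg _), ← ENNReal.ofReal_mul (Real.exp_nonneg _),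
      ← Real.exp_add, ← Real.exp_add]
    refine ENNReal.ofReal_le_ofReal (Real.exp_le_exp.2 ?_)
    push_cast [Nat.cast_sub hlt.le]
    simp only [hκ]
    linarith

lemma antitone_tsum_visitLoops (M : ℕ → ℕ → Prop) (q : ℕ) (f : ℕ × Pt → ℝ≥0∞) :
    Antitone fun m => ∑' p : visitLoops M q m, f p := fun _ _ h =>
  ENNReal.tsum_mono_subtype f fun _ hp => ⟨hp.1, h.trans hp.2⟩

lemma tendsto_tsum_visitLoops {M : ℕ → ℕ → Prop} {q : ℕ} {f : ℕ × Pt → ℝ≥0∞}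
    (hf : ∑' p : starLoops M, f p ≠ ∞) :
    Tendsto (fun m => ∑' p : visitLoops M q m, f p) atTop (nhds 0) := by
  rw [tsum_subtype] at hf
  refine ENNReal.tendsto_nhds_zero.2 fun ε hε => ?_
  obtain ⟨s, hs⟩ :=
    ((ENNReal.tendsto_nhds_zero.1 (ENNReal.tendsto_tsum_compl_atTop_zero hf)) ε hε).exists
  filter_upwards [eventually_gt_atTop (s.sup fun p => Nat.count (fun k => p.2 k ≤ q) p.1)] with m hm
  refine le_trans ?_ hs
  refine tsum_le_tsum_of_injOn (t := {p | p ∉ s}) (g := (starLoops M).indicator f)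
    id ?_ (injOn_id _) ?_
  · intro p hp hps
    have := Finset.le_sup (f := fun p : ℕ × Pt => Nat.count (fun k => p.2 k ≤ q) p.1) hps
    exact absurd (hp.2.trans this) (not_le.2 hm)
  · intro p hp
    rw [id, indicator_of_mem hp.1]

lemma exists_geometric_decay {T : ℕ → ℝ≥0∞} (hanti : Antitone T)
    (hlim : Tendsto T atTop (nhds 0)) {K : ℝ≥0∞} (hK : K ≠ ∞)
    (hsub : ∀ m k, 0 < m → 0 < k → T (m + k) ≤ K * (T m * T k)) :
    ∃ m > 0, ∀ j, T (j * m) ≤ 2 * T 0 * 2⁻¹ ^ j := by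
  have h1 : Tendsto (fun m => K * T m) atTop (nhds 0) := by
    simpa using ENNReal.Tendsto.const_mul hlim (Or.inr hK)
  have h2 : ∀ᶠ m in atTop, K * T m ≤ 2⁻¹ :=
    ENNReal.tendsto_nhds_zero.1 h1 _ (by simp)
  obtain ⟨m, hm, hpos⟩ := (h2.and (eventually_gt_atTop 0)).exists
  have hstep : ∀ j, T ((j + 1) * m) ≤ T 0 * 2⁻¹ ^ j := by
    intro j
    induction j with
    | zero => simpa using hanti (Nat.zero_le m)
    | succ j ih =>
      calc T ((j + 1 + 1) * m) = T ((j + 1) * m + m) := by ring_nf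
        _ ≤ K * (T ((j + 1) * m) * T m) := hsub _ _ (by positivity) hpos
        _ = T ((j + 1) * m) * (K * T m) := by ring
        _ ≤ (T 0 * 2⁻¹ ^ j) * 2⁻¹ := by gcongr
        _ = T 0 * 2⁻¹ ^ (j + 1) := by ring
  refine ⟨m, hpos, fun j => ?_⟩
  cases j with
  | zero =>
    rw [zero_mul, pow_zero, mul_one, two_mul]
    exact le_self_add
  | succ j =>
    refine (hstep j).trans (le_of_eq ?_)
    rw [pow_succ, mul_comm 2 (T 0), mul_assoc, mul_comm (2⁻¹ ^ j), ← mul_assoc 2,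
      ENNReal.mul_inv_cancel (by simp) (by simp), one_mul]

lemma inBSet.mono {M : ℕ → ℕ → Prop} {n m m' q q' : ℕ} {x : Pt} (h : inBSet M n m q x)
    (hm' : 0 < m') (hm : m' ≤ m) (hq : q' ≤ q) (h0 : x 0 ≤ q') (hn : x n ≤ q') :
    inBSet M n m' q' x := by
  refine ⟨h.1, h0, hn, le_trans ?_ (h.2.2.2.trans ?_)⟩
  · exact_mod_cast Finset.card_le_card
      (Finset.monotone_filter_right _ fun k _ (hk : x k ≤ q') => hk.trans hq)
  · have : (0 : ℝ) < m' := by exact_mod_cast hm'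
    gcongr

/-- First return loops at `0` of length `n` with few visits to `{0, …, q}`. -/
def fewVisits (M : ℕ → ℕ → Prop) (n m q : ℕ) : Set Pt :=
  {x | x ∈ PerStarSet M 0 n ∧ inBSet M n m q x}

lemma fewVisits_subset {M : ℕ → ℕ → Prop} {n m m' q q' : ℕ} (hm' : 0 < m') (hm : m' ≤ m)
    (hq : q' ≤ q) : fewVisits M n m q ⊆ fewVisits M n m' q' := by
  rintro x ⟨hx, hB⟩
  have hn : x n = 0 := by
    have := eq_add_of_periodic hx.2.1 0
    rwa [zero_add, hx.2.2.1] at this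
  exact ⟨hx, hB.mono hm' hm hq (hx.2.2.1.le.trans (Nat.zero_le _)) (hn.le.trans (Nat.zero_le _))⟩

lemma tsum_fewVisits_le_zCount {M : ℕ → ℕ → Prop} {n : ℕ} (hn : 0 < n) (m q : ℕ) :
    ∑' _x : fewVisits M n m q, (1 : ℝ≥0∞) ≤ zCount M n m q := by
  unfold zCount
  refine tsum_le_tsum_of_injOn (f := fun _ => 1) (g := fun _ => 1)
    (t := {w : Fin (n + 1) → ℕ | (∃ x : Pt, isAdmissible M x ∧ ∀ i : Fin (n + 1), x (i : ℕ) = w i) ∧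
      w 0 ≤ q ∧ w (Fin.last n) ≤ q ∧
      (((Finset.univ.filter (fun i : Fin (n + 1) => w i ≤ q)).card : ℝ) ≤ (n + 1 : ℝ) / (m : ℝ))})
    (fun x i => x i) ?_ ?_ (fun _ _ => le_rfl)
  · rintro x ⟨-, hB⟩
    refine ⟨⟨x, hB.1, fun _ => rfl⟩, hB.2.1, hB.2.2.1, ?_⟩
    have := hB.2.2.2
    rwa [Finset.card_filter, Fin.sum_univ_eq_sum_range (fun k => if x k ≤ q then 1 else 0),
      ← Finset.card_filter]
  · rintro x ⟨hx, -⟩ y ⟨hy, -⟩ h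
    refine periodic_ext hn hx.2.1 hy.2.1 fun k hk => ?_
    exact congrFun h ⟨k, by omega⟩

lemma tsum_fewVisits_le_Zn (M : ℕ → ℕ → Prop) (n m q : ℕ) :
    ∑' _x : fewVisits M n m q, (1 : ℝ≥0∞) ≤ Zn M (fun _ => 0) 0 n := by
  refine tsum_le_tsum_of_injOn (t := PerSet M 0 n) (f := fun _ => 1)
    (g := fun x => ENNReal.ofReal (Real.exp (birkhoff (fun _ => 0) n x)))
    id (fun x hx => ⟨hx.1.1, hx.1.2.1, hx.1.2.2.1⟩) (injOn_id _) fun x _ => ?_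
  simp [birkhoff]

lemma exists_tsum_fewVisits_le_exp_of_hInfty_lt {M : ℕ → ℕ → Prop} {c : ℝ}
    (h : hInfty M < (c : EReal)) :
    ∃ m > 0, ∃ q, ∀ᶠ n : ℕ in atTop,
      ∑' _x : fewVisits M n m q, (1 : ℝ≥0∞) ≤ ENNReal.ofReal (Real.exp (n * c)) := by
  obtain ⟨q, hq⟩ := (frequently_lt_of_liminf_lt (h := h)).exists
  obtain ⟨m, hm, hpos⟩ :=
    ((frequently_lt_of_liminf_lt (h := hq)).and_eventually (eventually_gt_atTop 0)).exists
  refine ⟨m, hpos, q, ?_⟩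
  filter_upwards [eventually_le_exp_of_limsup_lt hm, eventually_gt_atTop 0] with n hn hn0
  exact (tsum_fewVisits_le_zCount hn0 m q).trans hn

lemma exists_birkhoff_le_of_deltaInf_lt {M : ℕ → ℕ → Prop} {φ : Pt → ℝ} {c : ℝ}
    (h : deltaInf M φ < (c : EReal)) :
    ∃ m > 0, ∃ q, ∀ᶠ n : ℕ in atTop, ∀ x, inBSet M n m q x → birkhoff φ n x ≤ n * c := by
  obtain ⟨q, hq⟩ := (frequently_lt_of_liminf_lt (h := h)).exists
  obtain ⟨m, hm, hpos⟩ :=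
    ((frequently_lt_of_liminf_lt (h := hq)).and_eventually (eventually_gt_atTop 0)).exists
  refine ⟨m, hpos, q, ?_⟩
  filter_upwards [eventually_lt_of_limsup_lt hm, eventually_gt_atTop 0] with n hn hn0 x hx
  have h1 : ((birkhoff φ n x / n : ℝ) : EReal) ≤ zPhi M φ n m q :=
    le_iSup (fun x : {x : Pt // inBSet M n m q x} => ((birkhoff φ n x.1 / (n : ℝ) : ℝ) : EReal))
      ⟨x, hx⟩
  have h2 : birkhoff φ n x / n ≤ c := by exact_mod_cast h1.trans hn.le
  rw [div_le_iff₀ (by exact_mod_cast hn0)] at h2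
  linarith

lemma exists_real_bounds {δ h : EReal} {H P : ℝ} (hδ : δ < P) (hδh : δ + h < P) :
    ∃ d e : ℝ, δ < d ∧ d + e < P ∧ (h < e ∨ H < e) := by
  induction h with
  | bot =>
    obtain ⟨d, hd, -⟩ := EReal.lt_iff_exists_real_btwn.1 hδ
    exact ⟨d, P - d - 1, hd, by linarith, Or.inl (EReal.bot_lt_coe _)⟩
  | top =>
    have : δ = ⊥ := by
      by_contra hne
      rw [EReal.add_top_of_ne_bot hne] at hδh
      exact not_top_lt hδh
    exact ⟨P - H - 2, H + 1, this ▸ EReal.bot_lt_coe _, by linarith, Or.inr (by linarith)⟩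
  | coe h =>
    induction δ with
    | bot => exact ⟨P - h - 2, h + 1, EReal.bot_lt_coe _, by linarith,
        Or.inl (by exact_mod_cast lt_add_one h)⟩
    | top => exact absurd hδ not_top_lt
    | coe r =>
      have hrh : r + h < P := by exact_mod_cast hδh
      refine ⟨r + (P - r - h) / 3, h + (P - r - h) / 3, ?_, by linarith, Or.inl ?_⟩
      · exact EReal.coe_lt_coe_iff.2 (by linarith)
      · exact EReal.coe_lt_coe_iff.2 (by linarith)

/-- Loops with few visits to a finite set grow at an exponential rate less than `P`. -/
lemma exists_tsum_fewVisits_le_exp {M : ℕ → ℕ → Prop} {φ : Pt → ℝ} {H P : ℝ}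
    (hH : pressureAt M (fun _ => (0 : ℝ)) 0 = (H : EReal))
    (hCI : deltaInf M φ < (P : EReal)) (hsharp : deltaInf M φ + hInfty M < (P : EReal)) :
    ∃ c < P, ∃ m > 0, ∃ q, ∀ᶠ n : ℕ in atTop,
      ∑' x : fewVisits M n m q, ENNReal.ofReal (Real.exp (birkhoff φ n x)) ≤
        ENNReal.ofReal (Real.exp (n * c)) := by
  obtain ⟨d, e, hd, hde, he⟩ := exists_real_bounds (H := H) hCI hsharp
  obtain ⟨m₁, hm₁, q₁, h₁⟩ := exists_birkhoff_le_of_deltaInf_lt hd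
  obtain ⟨m₂, hm₂, q₂, h₂⟩ : ∃ m > 0, ∃ q, ∀ᶠ n : ℕ in atTop,
      ∑' _x : fewVisits M n m q, (1 : ℝ≥0∞) ≤ ENNReal.ofReal (Real.exp (n * e)) := by
    rcases he with he | he
    · exact exists_tsum_fewVisits_le_exp_of_hInfty_lt he
    · refine ⟨1, one_pos, 0, ?_⟩
      unfold pressureAt at hH
      filter_upwards [eventually_le_exp_of_limsup_lt (Z := Zn M (fun _ => 0) 0) (c := e)
        (by rw [hH]; exact_mod_cast he)] with n hn
      exact (tsum_fewVisits_le_Zn M n 1 0).trans hn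
  refine ⟨d + e, hde, max m₁ m₂, lt_max_of_lt_left hm₁, max q₁ q₂, ?_⟩
  filter_upwards [h₁, h₂] with n hn₁ hn₂
  have hs₁ : fewVisits M n (max m₁ m₂) (max q₁ q₂) ⊆ fewVisits M n m₁ q₁ :=
    fewVisits_subset hm₁ (le_max_left _ _) (le_max_left _ _)
  have hs₂ : fewVisits M n (max m₁ m₂) (max q₁ q₂) ⊆ fewVisits M n m₂ q₂ :=
    fewVisits_subset hm₂ (le_max_right _ _) (le_max_right _ _)
  calc ∑' x : fewVisits M n (max m₁ m₂) (max q₁ q₂), ENNReal.ofReal (Real.exp (birkhoff φ n x))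
      ≤ ∑' _x : fewVisits M n (max m₁ m₂) (max q₁ q₂), ENNReal.ofReal (Real.exp (n * d)) * 1 := by
        refine ENNReal.tsum_le_tsum fun x => ?_
        rw [mul_one]
        exact ENNReal.ofReal_le_ofReal (Real.exp_le_exp.2 (hn₁ _ (hs₁ x.2).2))
    _ = ENNReal.ofReal (Real.exp (n * d)) *
        ∑' _x : fewVisits M n (max m₁ m₂) (max q₁ q₂), 1 := ENNReal.tsum_mul_left
    _ ≤ ENNReal.ofReal (Real.exp (n * d)) * ENNReal.ofReal (Real.exp (n * e)) := by
        gcongr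
        exact (ENNReal.tsum_mono_subtype (fun _ => 1) hs₂).trans hn₂
    _ = ENNReal.ofReal (Real.exp (n * (d + e))) := by
        rw [← ENNReal.ofReal_mul (Real.exp_nonneg _), ← Real.exp_add, mul_add]

lemma ZnStar_le {M : ℕ → ℕ → Prop} {φ : Pt → ℝ} {n m : ℕ} (hn : 0 < n) (P : ℝ) (q : ℕ) :
    ZnStar M φ 0 n ≤ ∑' x : fewVisits M n m q, ENNReal.ofReal (Real.exp (birkhoff φ n x)) +
      ENNReal.ofReal (Real.exp (n * P)) * ∑' p : visitLoops M q ((n + 1) / m), weight φ P p := by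
  set g : Pt → ℝ≥0∞ := fun x => ENNReal.ofReal (Real.exp (birkhoff φ n x)) with hg
  set S : Set Pt := {x | x ∈ PerStarSet M 0 n ∧ ¬ inBSet M n m q x} with hS
  have hsub : PerStarSet M 0 n ⊆ fewVisits M n m q ∪ S := fun x hx => by
    by_cases hB : inBSet M n m q x
    · exact Or.inl ⟨hx, hB⟩
    · exact Or.inr ⟨hx, hB⟩
  refine (ENNReal.tsum_mono_subtype g hsub).trans ((ENNReal.tsum_union_le g _ _).trans ?_)
  gcongr
  rw [← ENNReal.tsum_mul_left]
  refine tsum_le_tsum_of_injOn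
    (g := fun p => ENNReal.ofReal (Real.exp (n * P)) * weight φ P p)
    (fun x => (n, x)) ?_ (fun _ _ _ _ h => (Prod.mk.inj h).2) ?_
  · rintro x ⟨hx, hB⟩
    refine ⟨⟨hn, hx⟩, ?_⟩
    by_contra! hlt
    dsimp only at hlt
    have hxn : x n = 0 := by
      have := eq_add_of_periodic hx.2.1 0
      rwa [zero_add, hx.2.2.1] at this
    refine hB ⟨hx.1, hx.2.2.1.le.trans (Nat.zero_le _), hxn.le.trans (Nat.zero_le _), ?_⟩
    rw [← Nat.count_eq_card_filter_range, Nat.count_succ, if_pos (hxn.le.trans (Nat.zero_le _))]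
    have h1 : ((Nat.count (fun k => x k ≤ q) n + 1 : ℕ) : ℝ) ≤ (((n + 1) / m : ℕ) : ℝ) := by
      exact_mod_cast hlt
    have h2 : (((n + 1) / m : ℕ) : ℝ) ≤ ((n + 1 : ℕ) : ℝ) / (m : ℝ) := Nat.cast_div_le
    exact_mod_cast h1.trans h2
  · rintro x -
    rw [weight_eq_mul, ← mul_assoc, ← ENNReal.ofReal_mul (Real.exp_nonneg _), ← Real.exp_add]
    simp [hg]

lemma half_pow_div_le {k : ℕ} (hk : 0 < k) (n : ℕ) :
    (2⁻¹ : ℝ≥0∞) ^ ((n + 1) / k) ≤ 2 * ENNReal.ofReal (Real.exp (-(n * (Real.log 2 / k)))) := by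
  have h2 : (2 : ℝ≥0∞) = ENNReal.ofReal 2 := by simp
  rw [h2, ← ENNReal.ofReal_inv_of_pos two_pos, ← ENNReal.ofReal_pow (by norm_num),
    ← ENNReal.ofReal_mul two_pos.le]
  refine ENNReal.ofReal_le_ofReal ?_
  set j := (n + 1) / k
  have hkR : (0 : ℝ) < k := by exact_mod_cast hk
  have hj : ((n : ℝ) + 1) < k * (j + 1) := by exact_mod_cast Nat.lt_mul_div_succ (n + 1) hk
  have hlog : 0 < Real.log 2 := Real.log_pos one_lt_two
  have hle : n * (Real.log 2 / k) ≤ (j + 1) * Real.log 2 := by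
    rw [← mul_div_assoc, div_le_iff₀ hkR]
    nlinarith
  calc (2⁻¹ : ℝ) ^ j = Real.exp (-(j * Real.log 2)) := by
        rw [Real.exp_neg, Real.exp_nat_mul, Real.exp_log two_pos, inv_pow]
    _ ≤ Real.exp (Real.log 2 + -(n * (Real.log 2 / k))) := Real.exp_le_exp.2 (by linarith)
    _ = 2 * Real.exp (-(n * (Real.log 2 / k))) := by
        rw [Real.exp_add, Real.exp_log two_pos]

end CMS


open CMS

/-- Theorem `thm:CI-SPR`.
Let `(Σ,σ)` be a topologically transitive countable Markov shift with finite
topological entropy `h_top = H < ∞`, and let `φ` have summable variations and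
finite Gurevich pressure `P = P(φ)`.  If (CI) holds, i.e. `δ_{φ,∞} < P(φ)`, and
moreover `δ_{φ,∞} + h_∞ < P(φ)`, then `φ` is strongly positive recurrent. -/
theorem CI_implies_SPR
    (M : ℕ → ℕ → Prop) (φ : Pt → ℝ)
    (htrans : TopTransitive M)
    (H : ℝ) (hH : ∀ a : ℕ, pressureAt M (fun _ => (0 : ℝ)) a = (H : EReal))
    (hsum : SummableVariations M φ)
    (P : ℝ) (hP : ∀ a : ℕ, pressureAt M φ a = (P : EReal))
    (hCI : deltaInf M φ < (P : EReal))
    (hsharp : deltaInf M φ + hInfty M < (P : EReal)) :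
    SPR M φ P := by
  obtain ⟨C, hC⟩ := hsum.exists_distortion
  obtain ⟨c, hcP, m, hm, q, hfew⟩ := exists_tsum_fewVisits_le_exp (hH 0) hCI hsharp
  set T : ℕ → ℝ≥0∞ := fun k => ∑' p : visitLoops M q k, weight φ P p with hT
  have hstar : ∑' p : starLoops M, weight φ P p ≠ ∞ :=
    ((tsum_weight_starLoops_le hC (hP 0)).trans_lt ENNReal.ofReal_lt_top).ne
  have hT0 : T 0 ≠ ∞ :=
    ne_top_of_le_ne_top hstar (ENNReal.tsum_mono_subtype (weight φ P) fun _ hp => hp.1)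
  have hanti : Antitone T := antitone_tsum_visitLoops M q (weight φ P)
  obtain ⟨K, hK, hsub⟩ := exists_tsum_visitLoops_add_le htrans hC P q
  obtain ⟨l, hl, hdecay⟩ :=
    exists_geometric_decay hanti (tendsto_tsum_visitLoops hstar) hK hsub
  have hml : 0 < m * l := Nat.mul_pos hm hl
  have hlog : 0 < Real.log 2 / ((m * l : ℕ) : ℝ) :=
    div_pos (Real.log_pos one_lt_two) (by exact_mod_cast hml)
  set b : ℝ := max c (P - Real.log 2 / ((m * l : ℕ) : ℝ)) with hb
  have hbP : b < P := max_lt hcP (by linarith)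
  obtain ⟨b', hbb', hb'P⟩ := exists_between hbP
  refine ⟨0, lt_of_le_of_lt ?_ (EReal.coe_lt_coe_iff.2 hb'P)⟩
  refine limsup_le_of_eventually_le_exp hbb' (K := 1 + 2 * T 0 * 2)
    (by finiteness) ?_
  filter_upwards [hfew, eventually_gt_atTop 0] with n hn hn0
  refine (ZnStar_le hn0 P q (m := m)).trans ?_
  rw [add_mul, one_mul]
  refine add_le_add (hn.trans ?_) ?_
  · gcongr
    exact le_max_left _ _
  · have hTn : T ((n + 1) / m) ≤ 2 * T 0 * 2⁻¹ ^ ((n + 1) / (m * l)) := by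
      rw [← Nat.div_div_eq_div_mul]
      exact (hanti (Nat.div_mul_le_self _ _)).trans (hdecay _)
    calc ENNReal.ofReal (Real.exp (n * P)) * T ((n + 1) / m)
        ≤ ENNReal.ofReal (Real.exp (n * P)) * (2 * T 0 *
          (2 * ENNReal.ofReal (Real.exp (-(n * (Real.log 2 / ((m * l : ℕ) : ℝ))))))) := by
          gcongr
          exact hTn.trans (by gcongr; exact half_pow_div_le hml n)
      _ = 2 * T 0 * 2 * (ENNReal.ofReal (Real.exp (n * P)) *
          ENNReal.ofReal (Real.exp (-(n * (Real.log 2 / ((m * l : ℕ) : ℝ)))))) := by ring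
      _ ≤ 2 * T 0 * 2 * ENNReal.ofReal (Real.exp (n * b)) := by
          rw [← ENNReal.ofReal_mul (Real.exp_nonneg _), ← Real.exp_add, ← sub_eq_add_neg,
            ← mul_sub]
          gcongr
          exact le_max_right _ _
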